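/- arXiv:0711.4079 — 2 statements merged into one kernel-verified Lean document; each statement's English description precedes it below -/
import Mathlib

section
/- Fix N, n ≥ 1 and let V = ℂ^N. Let 𝒱 = V^{⊗n} ⊗ ℂ[z_1,…,z_n], with S_n acting by permuting the tensor factors of V^{⊗n} and the variables z_1,…,z_n simultaneously, and let 𝒱^S be the subspace of S_n-invariants. Then 𝒱^S is a free module of rank N^n over the ring ℂ[z_1,…,z_n]^S of symmetric polynomials (acting by multiplication). -/
open scoped TensorProduct

/-- The simultaneous action of a permutation σ on 𝒱 = V^{⊗n} ⊗ ℂ[z₁,…,zₙ] :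
it permutes the tensor factors of the tensor power (v₁⊗…⊗vₙ ↦ v_{σ⁻¹(1)}⊗…⊗v_{σ⁻¹(n)})
and the variables of the polynomial (p(z₁,…,zₙ) ↦ p(z_{σ(1)},…,z_{σ(n)})). -/
noncomputable def permAct (N n : ℕ) (σ : Equiv.Perm (Fin n)) :
    ((⨂[ℂ] _i : Fin n, (Fin N → ℂ)) ⊗[ℂ] MvPolynomial (Fin n) ℂ) →ₗ[ℂ]
      ((⨂[ℂ] _i : Fin n, (Fin N → ℂ)) ⊗[ℂ] MvPolynomial (Fin n) ℂ) :=
  TensorProduct.map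
    ((PiTensorProduct.reindex ℂ (fun _ : Fin n => (Fin N → ℂ)) σ).toLinearMap)
    (MvPolynomial.rename σ).toLinearMap

/-- Multiplication by the polynomial p on 𝒱 = V^{⊗n} ⊗ ℂ[z₁,…,zₙ] (the module
structure over the polynomial ring). -/
noncomputable def polySmul (N n : ℕ) (p : MvPolynomial (Fin n) ℂ) :
    ((⨂[ℂ] _i : Fin n, (Fin N → ℂ)) ⊗[ℂ] MvPolynomial (Fin n) ℂ) →ₗ[ℂ]
      ((⨂[ℂ] _i : Fin n, (Fin N → ℂ)) ⊗[ℂ] MvPolynomial (Fin n) ℂ) :=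
  TensorProduct.map LinearMap.id (LinearMap.mulLeft ℂ p)

open MvPolynomial AddMonoidAlgebra Fin

lemma supDeg_expand {n N : ℕ} (hN : 1 ≤ N) (p : MvPolynomial (Fin n) ℂ) :
    supDegree toLex (expand N p) = toLex (N • ofLex (supDegree toLex p)) := by
  classical
  obtain rfl | h0 := eq_or_ne p 0
  · rw [map_zero, supDegree_zero, bot_eq_zero (α := Lex (Fin n →₀ ℕ))]
    simp
  obtain ⟨a, ha, he⟩ := exists_supDegree_mem_support (D := toLex) (p := p) h0
  rw [he, ofLex_toLex]
  have hs : (expand N p).support = _ := support_expand p (by omega)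
  apply supDegree_eq_of_isMaxOn
  · change N • a ∈ (expand N p).support
    rw [hs]
    exact Finset.mem_image_of_mem _ ha
  · intro b hb
    change b ∈ (expand N p).support at hb
    rw [hs, Finset.mem_image] at hb
    obtain ⟨c, hc, rfl⟩ := hb
    have : toLex c ≤ toLex a := he ▸ Finset.le_sup (f := toLex) hc
    exact nsmul_le_nsmul_right this N

lemma leadC_expand {n N : ℕ} (hN : 1 ≤ N) (p : MvPolynomial (Fin n) ℂ) :
    leadingCoeff toLex (expand N p) = leadingCoeff toLex p := by
  rw [leadingCoeff_toLex, leadingCoeff_toLex, supDeg_expand hN, ofLex_toLex,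
    coeff_expand_smul _ (by omega)]

/-- e^α -/
noncomputable def eMon {n N : ℕ} (a : Fin n → Fin N) : MvPolynomial (Fin n) ℂ :=
  esymmAlgHomMonomial (Fin n) (Finsupp.equivFunOnFinite.symm fun i => (a i : ℕ)) 1

lemma eMon_monic {n N : ℕ} (a : Fin n → Fin N) : Monic toLex (eMon a) :=
  leadingCoeff_esymmAlgHomMonomial _ le_rfl

lemma eMon_sup {n N : ℕ} (a : Fin n → Fin N) :
    ⇑(ofLex (supDegree toLex (eMon a))) = accumulate n n (fun i => (a i : ℕ)) :=
  supDegree_esymmAlgHomMonomial one_ne_zero _ le_rfl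

lemma supDeg_term {n N : ℕ} (hN : 1 ≤ N) (a : Fin n → Fin N) (p : MvPolynomial (Fin n) ℂ)
    (hp : p ≠ 0) : ⇑(ofLex (supDegree toLex (expand N p * eMon a))) =
      N • ⇑(ofLex (supDegree toLex p)) + accumulate n n (fun i => (a i : ℕ)) := by
  rw [Monic.supDegree_mul_of_ne_zero_left toLex.injective toLex_add (eMon_monic a)
    ((expand_ne_zero hN).2 hp), supDeg_expand hN, ofLex_add, Finsupp.coe_add, eMon_sup]
  simp

lemma leadC_term {n N : ℕ} (hN : 1 ≤ N) (a : Fin n → Fin N) (p : MvPolynomial (Fin n) ℂ) :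
    leadingCoeff toLex (expand N p * eMon a) = leadingCoeff toLex p := by
  rw [(eMon_monic a).leadingCoeff_mul_eq_left toLex.injective toLex_add, leadC_expand hN]

lemma key_unique {n N : ℕ} (hN : 1 ≤ N) (c : (Fin n → Fin N) → MvPolynomial (Fin n) ℂ)
    (hc : ∀ a, (c a).IsSymmetric) (h : ∑ a, expand N (c a) * eMon a = 0) : c = 0 := by
  classical
  by_contra hne
  obtain ⟨a0, ha0⟩ := Function.ne_iff.1 hne
  have hz : ∀ a, eMon (n := n) (N := N) a ≠ 0 := fun a => (eMon_monic a).ne_zero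
  have h' : ∑ a ∈ Finset.univ.filter (fun a => c a ≠ 0), expand N (c a) * eMon a = 0 := by
    refine (Finset.sum_filter_of_ne ?_).trans h
    intro a _ ha h0
    simp [h0] at ha
  revert h'
  refine sum_ne_zero_of_injOn_supDegree (D := toLex) ⟨a0, by simpa using ha0⟩ (fun a ha => ?_) ?_
  · exact mul_ne_zero ((expand_ne_zero hN).2 (by simpa using ha)) (hz a)
  · intro a ha b hb hab
    have ha : c a ≠ 0 := by simpa using ha
    have hb : c b ≠ 0 := by simpa using hb
    have hab := congrArg (fun x : Lex (Fin n →₀ ℕ) => ⇑(ofLex x)) hab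
    simp only [Function.comp] at hab
    rw [supDeg_term hN a _ ha, supDeg_term hN b _ hb,
      ← accumulate_invAccumulate le_rfl (hc a).antitone_supDegree,
      ← accumulate_invAccumulate le_rfl (hc b).antitone_supDegree,
      ← map_nsmul, ← map_nsmul, ← map_add, ← map_add] at hab
    have := accumulate_injective le_rfl hab
    funext i
    have hi := congrArg (· % N) (congrFun this i)
    simp [Nat.mod_eq_of_lt (a i).2, Nat.mod_eq_of_lt (b i).2] at hi
    exact Fin.ext hi

lemma isSymmetric_expand {n N : ℕ} {p : MvPolynomial (Fin n) ℂ} (hp : p.IsSymmetric) :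
    (expand N p).IsSymmetric := fun e => by rw [rename_expand, hp e]

lemma eMon_symm {n N : ℕ} (a : Fin n → Fin N) : (eMon a).IsSymmetric :=
  isSymmetric_esymmAlgHomMonomial _ _

lemma key_exists {n N : ℕ} (hN : 1 ≤ N) (p : MvPolynomial (Fin n) ℂ) (hp : p.IsSymmetric) :
    ∃ c : (Fin n → Fin N) → MvPolynomial (Fin n) ℂ,
    (∀ a, (c a).IsSymmetric) ∧ p = ∑ a, expand N (c a) * eMon a := by
  classical
  induction he : p.supDegree toLex using WellFoundedLT.induction generalizing p with | _ t ih
  subst he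
  obtain rfl | h0 := eq_or_ne p 0
  · exact ⟨0, fun a => (symmetricSubalgebra (Fin n) ℂ).zero_mem, by simp⟩
  let g := invAccumulate n n ⇑(ofLex (supDegree (toLex : (Fin n →₀ ℕ) → Lex (Fin n →₀ ℕ)) p))
  have hg : accumulate n n g = ⇑(ofLex <| p.supDegree toLex) :=
    accumulate_invAccumulate le_rfl hp.antitone_supDegree
  let a : Fin n → Fin N := fun i => ⟨g i % N, Nat.mod_lt _ hN⟩
  let b : Fin n →₀ ℕ := Finsupp.equivFunOnFinite.symm fun i => g i / N
  let r := p.leadingCoeff toLex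
  have hr : r ≠ 0 := (leadingCoeff_ne_zero toLex.injective).2 h0
  let q := esymmAlgHomMonomial (Fin n) b r
  have hq : leadingCoeff toLex q = r := leadingCoeff_esymmAlgHomMonomial _ le_rfl
  have hqs : q.IsSymmetric := isSymmetric_esymmAlgHomMonomial _ _
  have hq0 : q ≠ 0 := (leadingCoeff_ne_zero toLex.injective).1 (hq ▸ hr)
  have hd : p.supDegree toLex = supDegree toLex (expand N q * eMon a) := by
    rw [← ofLex_inj, DFunLike.ext'_iff, supDeg_term hN a q hq0,
      supDegree_esymmAlgHomMonomial hr _ le_rfl, ← map_nsmul, ← map_add, ← hg]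
    congr 1
    funext i
    simp [a, b, Nat.div_add_mod]
  have hts : (expand N q * eMon a).IsSymmetric := (isSymmetric_expand hqs).mul (eMon_symm a)
  have hfin : ∃ c : (Fin n → Fin N) → MvPolynomial (Fin n) ℂ,
      (∀ a, (c a).IsSymmetric) ∧ p - expand N q * eMon a = ∑ a, expand N (c a) * eMon a := by
    obtain hlt | heq := supDegree_sub_lt_of_leadingCoeff_eq toLex.injective hd
      (by rw [leadC_term hN, hq])
    · exact ih _ hlt _ (hp.sub hts) rfl
    · refine ⟨0, fun a => (symmetricSubalgebra (Fin n) ℂ).zero_mem, ?_⟩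
      rw [sub_eq_zero.2 heq]; simp
  obtain ⟨c, hc, hs⟩ := hfin
  refine ⟨c + Pi.single a q, fun a' => (hc a').add ?_, ?_⟩
  · by_cases h : a' = a
    · subst h; simpa using hqs
    · rw [Pi.single_eq_of_ne h]; exact (symmetricSubalgebra (Fin n) ℂ).zero_mem
  · rw [sub_eq_iff_eq_add.1 hs]
    simp only [Pi.add_apply, map_add, add_mul, Finset.sum_add_distrib]
    congr 1
    rw [Finset.sum_eq_single a]
    · simp
    · intro b _ hb; simp [hb]
    · simp

noncomputable def expEquiv (N n : ℕ) (hN : 1 ≤ N) : (Fin n → Fin N) × (Fin n →₀ ℕ) ≃ (Fin n →₀ ℕ) where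
  toFun x := Finsupp.equivFunOnFinite.symm (fun i => (x.1 i : ℕ)) + N • x.2
  invFun g := (fun i => ⟨g i % N, Nat.mod_lt _ hN⟩,
    Finsupp.equivFunOnFinite.symm fun i => g i / N)
  left_inv x := by
    ext i
    · simp [Nat.mod_eq_of_lt (x.1 i).2]
    · simp [Nat.add_mul_div_left _ _ hN, Nat.div_eq_of_lt (x.1 i).2]
  right_inv g := by
    ext i
    simp [Nat.mod_add_div]

abbrev VV (N n : ℕ) := (⨂[ℂ] _i : Fin n, (Fin N → ℂ)) ⊗[ℂ] MvPolynomial (Fin n) ℂ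

noncomputable def tB (N n : ℕ) : Module.Basis (Fin n → Fin N) ℂ (⨂[ℂ] _i : Fin n, (Fin N → ℂ)) :=
  Basis.piTensorProduct (fun _ => Pi.basisFun ℂ (Fin N))

noncomputable def vB (N n : ℕ) : Module.Basis ((Fin n → Fin N) × (Fin n →₀ ℕ)) ℂ (VV N n) :=
  (tB N n).tensorProduct (basisMonomials (Fin n) ℂ)

noncomputable def PhiE (N n : ℕ) (hN : 1 ≤ N) : VV N n ≃ₗ[ℂ] MvPolynomial (Fin n) ℂ :=
  (vB N n).equiv (basisMonomials (Fin n) ℂ) (expEquiv N n hN)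

lemma Phi_tmul (N n : ℕ) (hN : 1 ≤ N) (a : Fin n → Fin N) (q : MvPolynomial (Fin n) ℂ) :
    PhiE N n hN (tB N n a ⊗ₜ q) =
      monomial (Finsupp.equivFunOnFinite.symm (fun i => (a i : ℕ))) 1 * expand N q := by
  have : (PhiE N n hN).toLinearMap ∘ₗ (TensorProduct.mk ℂ _ _ (tB N n a)) =
      LinearMap.mulLeft ℂ (monomial (Finsupp.equivFunOnFinite.symm (fun i => (a i : ℕ))) 1) ∘ₗ
        (expand N).toLinearMap := by
    refine (basisMonomials (Fin n) ℂ).ext fun m => ?_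
    have h := (vB N n).equiv_apply (a, m) (basisMonomials (Fin n) ℂ) (expEquiv N n hN)
    simp only [vB, Module.Basis.tensorProduct_apply] at h
    simp only [LinearMap.comp_apply, TensorProduct.mk_apply, LinearEquiv.coe_coe, PhiE, vB]
    rw [h]
    simp [expEquiv, monomial_mul]
  exact LinearMap.congr_fun this q

lemma Phi_smul (N n : ℕ) (hN : 1 ≤ N) (p : MvPolynomial (Fin n) ℂ) (x : VV N n) :
    PhiE N n hN (polySmul N n p x) = expand N p * PhiE N n hN x := by
  have : (PhiE N n hN).toLinearMap ∘ₗ polySmul N n p =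
      LinearMap.mulLeft ℂ (expand N p) ∘ₗ (PhiE N n hN).toLinearMap := by
    refine (vB N n).ext fun ⟨a, m⟩ => ?_
    simp only [vB, polySmul, Module.Basis.tensorProduct_apply, LinearMap.comp_apply,
      LinearEquiv.coe_coe, TensorProduct.map_tmul, Phi_tmul, LinearMap.mulLeft_apply, map_mul,
      LinearMap.id_apply]
    ring
  exact LinearMap.congr_fun this x

lemma Phi_perm (N n : ℕ) (hN : 1 ≤ N) (σ : Equiv.Perm (Fin n)) (x : VV N n) :
    PhiE N n hN (permAct N n σ x) = rename σ (PhiE N n hN x) := by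
  have : (PhiE N n hN).toLinearMap ∘ₗ permAct N n σ =
      (rename σ).toLinearMap ∘ₗ (PhiE N n hN).toLinearMap := by
    refine (vB N n).ext fun ⟨a, m⟩ => ?_
    have h : PiTensorProduct.reindex ℂ (fun _ : Fin n => (Fin N → ℂ)) σ (tB N n a)
        = tB N n (a ∘ σ.symm) := by
      simp only [tB, Basis.piTensorProduct_apply]
      rw [PiTensorProduct.reindex_tprod]
      rfl
    simp only [vB, permAct, Module.Basis.tensorProduct_apply, LinearMap.comp_apply,
      LinearEquiv.coe_coe, TensorProduct.map_tmul, h, Phi_tmul, AlgHom.toLinearMap_apply, map_mul,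
      rename_expand, rename_monomial]
    congr 3
    ext i
    simp [Finsupp.mapDomain_equiv_apply]
  exact LinearMap.congr_fun this x

theorem stmt_3 (N n : ℕ) (hN : 1 ≤ N) (hn : 1 ≤ n) :
    ∃ v : Fin (N ^ n) → ((⨂[ℂ] _i : Fin n, (Fin N → ℂ)) ⊗[ℂ] MvPolynomial (Fin n) ℂ),
      (∀ (j : Fin (N ^ n)) (σ : Equiv.Perm (Fin n)), permAct N n σ (v j) = v j) ∧
      ∀ x : (⨂[ℂ] _i : Fin n, (Fin N → ℂ)) ⊗[ℂ] MvPolynomial (Fin n) ℂ,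
        (∀ σ : Equiv.Perm (Fin n), permAct N n σ x = x) →
        ∃! c : Fin (N ^ n) → MvPolynomial (Fin n) ℂ,
          (∀ j, (c j).IsSymmetric) ∧ x = ∑ j, polySmul N n (c j) (v j) := by
  let E : Fin (N ^ n) ≃ (Fin n → Fin N) := finFunctionFinEquiv.symm
  let F := PhiE N n hN
  let v : Fin (N ^ n) → VV N n := fun j => F.symm (eMon (E j))
  have hsum : ∀ c : Fin (N ^ n) → MvPolynomial (Fin n) ℂ,
      F (∑ j, polySmul N n (c j) (v j)) = ∑ a, expand N (c (E.symm a)) * eMon a := by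
    intro c
    rw [map_sum, ← E.sum_comp]
    refine Finset.sum_congr rfl fun j _ => ?_
    rw [Phi_smul]
    simp [v, F]
  refine ⟨v, fun j σ => ?_, fun x hx => ?_⟩
  · apply F.injective
    rw [Phi_perm]
    simp only [v, F, LinearEquiv.apply_symm_apply]
    exact eMon_symm _ σ
  · have hs : (F x).IsSymmetric := fun σ => by rw [← Phi_perm, hx]
    obtain ⟨c, hc, hxc⟩ := key_exists hN (F x) hs
    refine ⟨c ∘ E, ⟨fun j => hc _, F.injective ?_⟩, ?_⟩
    · rw [hsum, hxc]; simp
    · rintro d ⟨hd, hxd⟩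
      have h1 := hsum d
      rw [← hxd, hxc] at h1
      have := key_unique hN (fun a => d (E.symm a) - c a) (fun a => (hd _).sub (hc a)) (by
        simp only [map_sub, sub_mul, Finset.sum_sub_distrib, ← h1, sub_self])
      funext j
      have := congrFun this (E j)
      simpa [sub_eq_zero] using this
end

section
/- Let N ≥ 1, let d_1 > d_2 > … > d_N ≥ 0 be integers, let f_1,…,f_N ∈ ℂ[u] be monic polynomials with deg f_i = d_i, and set n = Σ_i d_i − N(N−1)/2. For i = 0, 1, …, N define G_i ∈ ℂ[u] by G_i = (−1)^i det M_i, where M_i is the N×N matrix whose m-th row consists of the derivatives f_m, f_m', …, f_m^{(N)} with the (N−i)-th derivative omitted (so G_0 is the Wronskian of f_1,…,f_N). Then each G_i has degree at most n − i, and the following identity of polynomials in a variable α holds: Σ_{i=0}^N c_i · ∏_{j=0}^{N−i−1} (α − j) = (∏_{1 ≤ i < j ≤ N} (d_j − d_i)) · ∏_{i=1}^N (α − d_i), where c_i denotes the coefficient of u^{n−i} in G_i. (Equivalently: the indicial polynomial at infinity of the monic differential operator with kernel span(f_1,…,f_N) equals ∏_{i=1}^N (α − d_i).) -/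
/-- The Wronskian of N polynomials: the determinant of the N×N matrix whose (i,j) entry
is the (j−1)-st derivative of the i-th polynomial (indices 0-based). -/
noncomputable def wron (N : ℕ) (f : Fin N → Polynomial ℂ) : Polynomial ℂ :=
  (Matrix.of fun i j : Fin N => (Polynomial.derivative^[(j : ℕ)] (f i))).det

/-- G_i = (−1)^i times the determinant of the N×N matrix whose m-th row consists of the
derivatives of f_m of orders 0,1,…,N with the order N−i omitted.  (G_0 is the
Wronskian; the G_i are the polynomial coefficients of ∂^{N−i} in the row-determinant
expansion of the annihilating operator of f₁,…,f_N.) -/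
noncomputable def Gcoef (N : ℕ) (f : Fin N → Polynomial ℂ) (i : ℕ) : Polynomial ℂ :=
  (-1 : Polynomial ℂ) ^ i *
    (Matrix.of fun m j : Fin N =>
      (Polynomial.derivative^[if (j : ℕ) < N - i then (j : ℕ) else (j : ℕ) + 1]
        (f m))).det

open Polynomial in
lemma aux_prod {ι : Type*} (s : Finset ι) (p : ι → ℂ[X]) (d : ι → ℕ)
    (h : ∀ i, (p i).natDegree ≤ d i) :
    (∏ i ∈ s, p i).natDegree ≤ ∑ i ∈ s, d i ∧
    (∏ i ∈ s, p i).coeff (∑ i ∈ s, d i) = ∏ i ∈ s, (p i).coeff (d i) := by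
  classical
  induction s using Finset.induction_on with
  | empty => simp
  | insert a s ha ih =>
    rw [Finset.prod_insert ha, Finset.sum_insert ha, Finset.prod_insert ha]
    exact ⟨natDegree_mul_le_of_le (h a) ih.1, by
      rw [coeff_mul_add_eq_of_natDegree_le (h a) ih.1, ih.2]⟩

open Polynomial in
lemma aux_det (N : ℕ) (A : Matrix (Fin N) (Fin N) ℂ[X]) (d : Fin N → ℕ)
    (h : ∀ i j, (A i j).natDegree ≤ d i) :
    A.det.natDegree ≤ ∑ i, d i ∧
    A.det.coeff (∑ i, d i) = (Matrix.of fun i j => (A i j).coeff (d i)).det := by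
  rw [← Matrix.det_transpose A, ← Matrix.det_transpose (Matrix.of _)]
  rw [Matrix.det_apply, Matrix.det_apply]
  have key := fun σ : Equiv.Perm (Fin N) =>
    aux_prod Finset.univ (fun i => A i (σ i)) d (fun i => h i _)
  constructor
  · apply natDegree_sum_le_of_forall_le
    intro σ _
    exact (natDegree_smul_le _ _).trans (key σ).1
  · rw [finsetSum_coeff]
    refine Finset.sum_congr rfl fun σ _ => ?_
    have := (key σ).2
    simp only [Matrix.transpose_apply, Matrix.of_apply, coeff_smul]
    rw [this]

open Polynomial in
lemma aux_deriv (p : ℂ[X]) (d k : ℕ) (hm : p.Monic) (hd : p.natDegree = d) :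
    (X ^ k * derivative^[k] p).natDegree ≤ d ∧
    (X ^ k * derivative^[k] p).coeff d = (descPochhammer ℂ k).eval (d : ℂ) := by
  have h1 : p.coeff d = 1 := by rw [← hd]; exact hm
  rw [descPochhammer_eval_eq_descFactorial]
  constructor
  · rw [natDegree_le_iff_coeff_eq_zero]
    intro m hm
    rw [coeff_X_pow_mul']
    split_ifs with h
    · rw [coeff_iterate_derivative, Nat.sub_add_cancel h,
        coeff_eq_zero_of_natDegree_lt (by omega), smul_zero]
    · rfl
  · rw [coeff_X_pow_mul']
    split_ifs with h
    · rw [coeff_iterate_derivative, Nat.sub_add_cancel h, h1]; simp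
    · rw [Nat.descFactorial_eq_zero_iff_lt.2 (by omega)]; simp

open Polynomial in
lemma aux_van (N : ℕ) (d : Fin N → ℕ) :
    ∑ k : Fin (N + 1), (-1 : ℂ[X]) ^ (N + (k : ℕ)) *
      (∏ j ∈ Finset.range (k : ℕ), (X - C (j : ℂ))) *
      C (Matrix.of fun m j : Fin N =>
        (descPochhammer ℂ (k.succAbove j : ℕ)).eval (d m : ℂ)).det =
    C (∏ i : Fin N, ∏ j ∈ Finset.Ioi i, ((d j : ℂ) - (d i : ℂ))) *
        ∏ i : Fin N, (X - C ((d i : ℕ) : ℂ)) := by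
  let v : Fin (N + 1) → ℂ[X] := Fin.snoc (α := fun _ => ℂ[X]) (fun i => C (d i : ℂ)) X
  have hv : ∀ i : Fin N, v i.castSucc = C (d i : ℂ) := fun i => by simp [v]
  have hl : v (Fin.last N) = X := by simp [v]
  have h := Matrix.det_eval_matrixOfPolynomials_eq_det_vandermonde v
    (fun k : Fin (N + 1) => descPochhammer ℂ[X] (k : ℕ))
    (fun k => descPochhammer_natDegree _ _) (fun k => monic_descPochhammer _ _)
  have hR : (Matrix.vandermonde v).det =
      C (∏ i : Fin N, ∏ j ∈ Finset.Ioi i, ((d j : ℂ) - (d i : ℂ))) *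
        ∏ i : Fin N, (X - C ((d i : ℕ) : ℂ)) := by
    rw [Matrix.det_vandermonde, Fin.prod_univ_castSucc]
    have hI : Finset.Ioi (Fin.last N) = ∅ := by ext x; simp [Fin.le_last]
    have hJ : ∀ i : Fin N, Finset.Ioi i.castSucc =
        insert (Fin.last N) ((Finset.Ioi i).map Fin.castSuccEmb) := by
      intro i
      ext x
      refine Fin.lastCases ?_ (fun y => ?_) x
      · simp [Fin.castSucc_lt_last]
      · simp [Fin.le_last]
    rw [hI, Finset.prod_empty, mul_one, map_prod, ← Finset.prod_mul_distrib]
    refine Finset.prod_congr rfl fun i _ => ?_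
    rw [hJ, Finset.prod_insert (by simp [(Fin.castSucc_lt_last _).ne]), Finset.prod_map]
    simp only [Fin.coe_castSuccEmb, hv, hl, map_prod, map_sub]
    ring
  rw [← hR, h, Matrix.det_succ_row _ (Fin.last N)]
  refine Finset.sum_congr rfl fun k _ => ?_
  congr 1
  · simp only [Fin.val_last, Matrix.of_apply, hl, descPochhammer_eval_eq_prod_range]
    simp
  · rw [RingHom.map_det]
    congr 1
    ext1 m j
    simp only [RingHom.mapMatrix_apply, Matrix.map_apply, Matrix.of_apply, Matrix.submatrix_apply,
      Fin.succAbove_last, hv]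
    simp only [descPochhammer_eval_eq_prod_range]
    simp

lemma aux_sum (N : ℕ) (d : Fin N → ℕ)
    (hd : ∀ i j : Fin N, i < j → d j < d i) : N * (N - 1) / 2 ≤ ∑ i, d i := by
  have h : ∀ k (hk : k < N), k ≤ d (Fin.rev ⟨k, hk⟩) := by
    intro k
    induction k with
    | zero => intro _; omega
    | succ k ih =>
      intro hk
      have := ih (by omega)
      have := hd (Fin.rev ⟨k+1, hk⟩) (Fin.rev ⟨k, by omega⟩) (by
        rw [Fin.rev_lt_rev]; simp)
      omega
  rw [← Finset.sum_range_id, ← Fin.sum_univ_eq_sum_range (fun i => i), ← Equiv.sum_comp Fin.revPerm d]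
  exact Finset.sum_le_sum fun i _ => h i i.2

open Polynomial in
lemma aux_G (N : ℕ) (d : Fin N → ℕ) (f : Fin N → ℂ[X])
    (hmonic : ∀ i, (f i).Monic) (hdeg : ∀ i, (f i).natDegree = d i)
    (i : ℕ) (hi : i ≤ N) (k : Fin (N + 1)) (hk : (k : ℕ) = N - i) :
    (X ^ (N * (N - 1) / 2 + i) * Gcoef N f i).natDegree ≤ ∑ m, d m ∧
    (X ^ (N * (N - 1) / 2 + i) * Gcoef N f i).coeff (∑ m, d m) =
      (-1) ^ i * (Matrix.of fun m j : Fin N =>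
        (descPochhammer ℂ (k.succAbove j : ℕ)).eval (d m : ℂ)).det := by
  have hs : ∑ j : Fin N, (k.succAbove j : ℕ) = N * (N - 1) / 2 + i := by
    have h1 := Fin.sum_univ_succAbove (fun j : Fin (N + 1) => (j : ℕ)) k
    rw [Fin.sum_univ_castSucc] at h1
    simp only [Fin.val_castSucc, Fin.val_last] at h1
    rw [Fin.sum_univ_eq_sum_range (fun i => i), Finset.sum_range_id] at h1
    omega
  have hkj : ∀ j : Fin N, (if (j : ℕ) < N - i then (j : ℕ) else (j : ℕ) + 1)
      = (k.succAbove j : ℕ) := by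
    intro j
    rw [Fin.succAbove]
    simp only [Fin.lt_def, Fin.val_castSucc, hk]
    split_ifs <;> simp
  have hG : X ^ (N * (N - 1) / 2 + i) * Gcoef N f i = C ((-1) ^ i) *
      (Matrix.of fun m j : Fin N => X ^ (k.succAbove j : ℕ) *
        derivative^[(k.succAbove j : ℕ)] (f m)).det := by
    have := Matrix.det_mul_row (fun j : Fin N => (X : ℂ[X]) ^ (k.succAbove j : ℕ))
      (Matrix.of fun m j : Fin N => derivative^[(k.succAbove j : ℕ)] (f m))
    simp only [Matrix.of_apply] at this
    rw [this, Finset.prod_pow_eq_pow_sum, hs, Gcoef]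
    simp only [hkj]
    simp only [map_pow, map_neg, map_one]
    ring
  have h := aux_det N (Matrix.of fun m j : Fin N => X ^ (k.succAbove j : ℕ) *
        derivative^[(k.succAbove j : ℕ)] (f m)) d
        (fun m j => (aux_deriv (f m) (d m) _ (hmonic m) (hdeg m)).1)
  rw [hG]
  refine ⟨(natDegree_C_mul_le _ _).trans h.1, ?_⟩
  rw [coeff_C_mul, h.2]
  simp only [Matrix.of_apply]
  simp only [(aux_deriv (f _) (d _) _ (hmonic _) (hdeg _)).2]

/-- For monic polynomials f₁,…,f_N of strictly decreasing degrees
d₁ > … > d_N ≥ 0 and n = Σ dᵢ − N(N−1)/2, each G_i has degree at most n − i, and,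
letting c_i be the coefficient of u^{n−i} in G_i, the indicial polynomial identity
Σ_{i=0}^N c_i ∏_{j=0}^{N−i−1} (α − j) = (∏_{i<j} (d_j − d_i)) ∏_{i=1}^N (α − d_i)
holds in ℂ[α]. -/
theorem stmt_15 (N : ℕ) (hN : 1 ≤ N) (d : Fin N → ℕ)
    (hd : ∀ i j : Fin N, i < j → d j < d i)
    (f : Fin N → Polynomial ℂ)
    (hmonic : ∀ i, (f i).Monic) (hdeg : ∀ i, (f i).natDegree = d i)
    (n : ℕ) (hn : n = (∑ i, d i) - N * (N - 1) / 2)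
    (c : ℕ → ℂ)
    (hc : ∀ i, c i = if i ≤ n then (Gcoef N f i).coeff (n - i) else 0) :
    (∀ i ≤ N, (Gcoef N f i).natDegree ≤ n - i) ∧
    ∑ i ∈ Finset.range (N + 1),
        Polynomial.C (c i) *
          ∏ j ∈ Finset.range (N - i), (Polynomial.X - Polynomial.C (j : ℂ)) =
      Polynomial.C (∏ i : Fin N, ∏ j ∈ Finset.Ioi i, ((d j : ℂ) - (d i : ℂ))) *
        ∏ i : Fin N, (Polynomial.X - Polynomial.C ((d i : ℕ) : ℂ)) := by
  have hsum := aux_sum N d hd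
  have hG := fun i hi => aux_G N d f hmonic hdeg i hi ⟨N - i, by omega⟩ rfl
  constructor
  · intro i hi
    by_cases h0 : Gcoef N f i = 0
    · simp [h0]
    have h := (hG i hi).1
    rw [Polynomial.natDegree_X_pow_mul _ h0] at h
    omega
  · rw [← aux_van N d, Finset.sum_range, ← Equiv.sum_comp Fin.revPerm]
    refine Finset.sum_congr rfl fun k _ => ?_
    have hkN : (k : ℕ) ≤ N := by omega
    have hr : ((Fin.revPerm k : Fin (N + 1)) : ℕ) = N - k := by simp [Fin.val_rev]
    have hNk : N - (N - (k : ℕ)) = k := by omega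
    have hcc : c (N - k) = (-1) ^ (N - (k : ℕ)) * (Matrix.of fun m j : Fin N =>
        (descPochhammer ℂ (k.succAbove j : ℕ)).eval (d m : ℂ)).det := by
      have h := (aux_G N d f hmonic hdeg (N - k) (by omega) k hNk.symm).2
      rw [← h, hc, Polynomial.coeff_X_pow_mul']
      by_cases h1 : N - (k : ℕ) ≤ n
      · rw [if_pos h1, if_pos (by omega)]
        congr 1
        omega
      · rw [if_neg h1, if_neg (by omega)]
    rw [hr, hNk, hcc]
    have hsg : (-1 : Polynomial ℂ) ^ (N + (k : ℕ)) = (-1) ^ (N - (k : ℕ)) := by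
      have : N + (k : ℕ) = (N - k) + 2 * k := by omega
      rw [this, pow_add, pow_mul]; simp
    rw [hsg]
    simp only [map_mul, map_pow, map_neg, map_one]
    ring
end
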